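/- Let K be a finite set of players, and for each k ∈ K let S k be a finite nonempty strategy set, with utility functions U : Π (k : K), ((Π j, S j) → ℝ). If the game admits an exact potential function Φ : (Π k, S k) → ℝ (i.e., for all k, ζ, and s' : S k, U k (Function.update ζ k s') - U k ζ = Φ (Function.update ζ k s') - Φ ζ), then the game has a pure-strategy Nash equilibrium: there exists a profile ζ* such that for every player k and every s' : S k, U k (Function.update ζ* k s') ≤ U k ζ*. -/

import Mathlib

/-- Every finite game (finite player set, finite nonempty strategy
sets) admitting an exact potential function has a pure-strategy Nash
equilibrium. -/
theorem finite_potential_game_has_pure_nash_equilibrium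
    {K : Type*} [Fintype K] [DecidableEq K] {S : K → Type*}
    [∀ k, Fintype (S k)] [∀ k, Nonempty (S k)]
    (U : ∀ k : K, (∀ j, S j) → ℝ)
    (Φ : (∀ j, S j) → ℝ)
    (hΦ : ∀ (k : K) (ζ : ∀ j, S j) (s' : S k),
      U k (Function.update ζ k s') - U k ζ =
        Φ (Function.update ζ k s') - Φ ζ) :
    ∃ ζstar : ∀ j, S j, ∀ (k : K) (s' : S k),
      U k (Function.update ζstar k s') ≤ U k ζstar := by
  obtain ⟨ζ, hζ⟩ := Finite.exists_max Φ
  refine ⟨ζ, fun k s' => ?_⟩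
  have h1 := hΦ k ζ s'
  have h2 := hζ (Function.update ζ k s')
  linarith
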